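/- arXiv:1804.03453 — 2 statements merged into one kernel-verified Lean document; each statement's English description precedes it below -/
import Mathlib

section
/- SAS parity games are determined: in every finite sure-almost-sure parity game G and from every configuration v, either Player 0 wins from v, or Player 1 wins from v (i.e., if Player 0 has no winning strategy from v, then Player 1 has a single strategy π such that for every Player-0 strategy σ, either some play from v consistent with σ and π is not in W_s, or Prob_{v(σ,π)}(W_as) < 1). -/
open MeasureTheory

/-- The set of elements occurring infinitely often in an infinite sequence. -/
def InfOcc {α : Type*} (s : ℕ → α) : Set α := {v | ∀ n, ∃ m, n ≤ m ∧ s m = v}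

/-- The minimal priority occurring infinitely often. -/
noncomputable def minPrio {α : Type*} (p : α → ℕ) (s : ℕ → α) : ℕ := sInf (p '' InfOcc s)

/-- The parity condition induced by a priority function. -/
def ParityWin {α : Type*} (p : α → ℕ) : Set (ℕ → α) := {s | Even (minPrio p s)}

/-- The history of a play up to (excluding) time `n`. -/
def hist {α : Type*} (p : ℕ → α) (n : ℕ) : List α := (List.range n).map p

/-- A finite stochastic game graph together with two priority functions:
`ps` inducing the sure parity condition and `pas` inducing the almost-sure one. -/
structure SASGame (V : Type) [Fintype V] where
  V0 : Set V
  V1 : Set V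
  Vp : Set V
  cover : V0 ∪ V1 ∪ Vp = Set.univ
  disj01 : Disjoint V0 V1
  disj0p : Disjoint V0 Vp
  disj1p : Disjoint V1 Vp
  E : V → V → Prop
  succ_nonempty : ∀ v, ∃ w, E v w
  κ : V → V → ENNReal
  κ_pos : ∀ v ∈ Vp, ∀ w, (0 < κ v w ↔ E v w)
  κ_sum : ∀ v ∈ Vp, ∑ w, κ v w = 1
  ps : V → ℕ
  pas : V → ℕ

variable {V : Type} [Fintype V]

/-- A strategy: given the past history and the current configuration, choose a successor. -/
abbrev Strat (V : Type) := List V → V → V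

/-- A valid Player-0 strategy respects the edge relation on Player-0 configurations. -/
def SASGame.Valid0 (G : SASGame V) (σ : Strat V) : Prop := ∀ h v, v ∈ G.V0 → G.E v (σ h v)

/-- A valid Player-1 strategy respects the edge relation on Player-1 configurations. -/
def SASGame.Valid1 (G : SASGame V) (π : Strat V) : Prop := ∀ h v, v ∈ G.V1 → G.E v (π h v)

/-- A strategy is memoryless if it only depends on the current configuration. -/
def Memoryless {V : Type} (σ : Strat V) : Prop := ∀ h h' v, σ h v = σ h' v

/-- `v(σ)`: the plays from `v` consistent with the Player-0 strategy `σ`. -/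
def SASGame.PlaysFrom (G : SASGame V) (v : V) (σ : Strat V) : Set (ℕ → V) :=
  {p | p 0 = v ∧ (∀ n, G.E (p n) (p (n + 1))) ∧
    ∀ n, p n ∈ G.V0 → p (n + 1) = σ (hist p n) (p n)}

/-- The plays from `v` consistent with both strategies `σ` and `π`. -/
def SASGame.Plays2 (G : SASGame V) (v : V) (σ π : Strat V) : Set (ℕ → V) :=
  {p | p ∈ G.PlaysFrom v σ ∧ ∀ n, p n ∈ G.V1 → p (n + 1) = π (hist p n) (p n)}

open Classical in
/-- One-step transition probability of the Markov chain `v(σ,π)`. -/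
noncomputable def SASGame.step (G : SASGame V) (σ π : Strat V)
    (past : List V) (cur nxt : V) : ENNReal :=
  if cur ∈ G.V0 then (if nxt = σ past cur then 1 else 0)
  else if cur ∈ G.V1 then (if nxt = π past cur then 1 else 0)
  else G.κ cur nxt

open Classical in
/-- Probability of the cylinder determined by the first `n+1` configurations of `h`. -/
noncomputable def SASGame.cylProb (G : SASGame V) (v : V) (σ π : Strat V)
    (h : ℕ → V) (n : ℕ) : ENNReal :=
  (if h 0 = v then 1 else 0) * ∏ i ∈ Finset.range n, G.step σ π (hist h i) (h i) (h (i + 1))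

/-- The product σ-algebra on plays. -/
def playMS (V : Type) : MeasurableSpace (ℕ → V) :=
  @MeasurableSpace.pi ℕ (fun _ => V) (fun _ => ⊤)

/-- `μ` is the probability measure of the Markov chain `v(σ,π)`: it is the (unique)
probability measure on plays assigning to every cylinder the product of the
transition probabilities along it. -/
def SASGame.IsPlayMeasure (G : SASGame V) (v : V) (σ π : Strat V)
    (μ : @Measure (ℕ → V) (playMS V)) : Prop :=
  μ Set.univ = 1 ∧
    ∀ (h : ℕ → V) (n : ℕ), μ {p | ∀ i ≤ n, p i = h i} = G.cylProb v σ π h n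

/-- Player 0 wins from `v` with strategy `σ`. -/
def SASGame.Wins0Via (G : SASGame V) (v : V) (σ : Strat V) : Prop :=
  G.Valid0 σ ∧ G.PlaysFrom v σ ⊆ ParityWin G.ps ∧
    ∀ π, G.Valid1 π → ∀ μ, G.IsPlayMeasure v σ π μ → μ (ParityWin G.pas) = 1

/-- Player 0 wins from `v`: she has a strategy `σ` such that all plays consistent with
`σ` satisfy the sure parity condition and, against every Player-1 strategy, the
almost-sure parity condition holds with probability 1. -/
def SASGame.Wins0 (G : SASGame V) (v : V) : Prop := ∃ σ, G.Wins0Via v σ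

/-- Player 1 wins from `v` with strategy `π`. -/
def SASGame.Wins1Via (G : SASGame V) (v : V) (π : Strat V) : Prop :=
  G.Valid1 π ∧ ∀ σ, G.Valid0 σ →
    (∃ p ∈ G.Plays2 v σ π, p ∉ ParityWin G.ps) ∨
    (∀ μ, G.IsPlayMeasure v σ π μ → μ (ParityWin G.pas) < 1)

/-- Player 1 wins from `v`. -/
def SASGame.Wins1 (G : SASGame V) (v : V) : Prop := ∃ π, G.Wins1Via v π

theorem hist_length {α : Type*} (p : ℕ → α) (n : ℕ) : (hist p n).length = n := by
  simp [hist]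

theorem hist_succ {α : Type*} (p : ℕ → α) (n : ℕ) : hist p (n + 1) = hist p n ++ [p n] := by
  simp [hist, List.range_succ]

theorem hist_prefix {α : Type*} (p : ℕ → α) {m n : ℕ} (h : m ≤ n) : hist p m <+: hist p n := by
  induction n, h using Nat.le_induction with
  | base => exact List.prefix_rfl
  | succ n _ ih => exact ih.trans ⟨[p n], (hist_succ p n).symm⟩

theorem eq_hist_of_prefix {α : Type*} {p : ℕ → α} {l : List α} {n : ℕ} (h : l <+: hist p n) :
    l = hist p l.length :=
  (List.prefix_of_prefix_length_le h (hist_prefix p (by simpa [hist_length] using h.length_le))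
    (by simp [hist_length])).eq_of_length (by simp [hist_length])

theorem hist_getElem {α : Type*} (p : ℕ → α) {n i : ℕ} (h : i < (hist p n).length) :
    (hist p n)[i] = p i := by
  simp [hist]

theorem append_singleton_prefix {α : Type*} {l m : List α} (h : l <+: m) (hne : l ≠ m) :
    ∃ y, l ++ [y] <+: m := by
  obtain ⟨t, rfl⟩ := h
  cases t with
  | nil => simp at hne
  | cons y t => exact ⟨y, t, by simp⟩

/-- An unbounded increasing chain of lists converges to an infinite sequence. -/
theorem exists_limit_of_chain {α : Type*} [Nonempty α] (f : ℕ → List α)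
    (hf : ∀ n, f n <+: f (n + 1)) (hub : ∀ k, ∃ n, k < (f n).length) :
    ∃ p : ℕ → α, ∀ n, f n = hist p (f n).length := by
  have mono : ∀ {m n}, m ≤ n → f m <+: f n := by
    intro m n h
    induction n, h using Nat.le_induction with
    | base => exact List.prefix_rfl
    | succ n _ ih => exact ih.trans (hf n)
  choose N hN using hub
  refine ⟨fun k => (f (N k))[k]'(hN k), fun n => ?_⟩
  apply List.ext_getElem
  · simp [hist_length]
  · intro i h1 h2
    rw [hist_getElem]
    rcases le_total n (N i) with h | h
    · exact (mono h).getElem h1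
    · exact ((mono h).getElem (hN i)).symm

/-- The finite histories from `v` consistent with the Player-0 strategy `σ`. -/
inductive SASGame.Consistent (G : SASGame V) (v : V) (σ : Strat V) : List V → Prop
  | root : G.Consistent v σ [v]
  | snoc (h : List V) (u x : V) : G.Consistent v σ (h ++ [u]) → G.E u x →
      (u ∈ G.V0 → x = σ h u) → G.Consistent v σ (h ++ [u] ++ [x])

theorem SASGame.Consistent.ne_nil {G : SASGame V} {v : V} {σ : Strat V} {l : List V}
    (h : G.Consistent v σ l) : l ≠ [] := by
  cases h <;> simp

theorem SASGame.Consistent.snoc_inv {G : SASGame V} {v : V} {σ : Strat V} {h : List V} {u x : V}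
    (hc : G.Consistent v σ (h ++ [u] ++ [x])) :
    G.Consistent v σ (h ++ [u]) ∧ G.E u x ∧ (u ∈ G.V0 → x = σ h u) := by
  generalize hl : h ++ [u] ++ [x] = l at hc
  cases hc with
  | root => simpa using congrArg List.length hl
  | snoc h' u' x' h1 h2 h3 =>
    obtain ⟨hl, hx⟩ := List.append_inj' hl rfl
    obtain ⟨rfl, hu⟩ := List.append_inj' hl rfl
    simp only [List.cons.injEq, and_true] at hx hu
    subst hx hu
    exact ⟨h1, h2, h3⟩

theorem SASGame.Consistent.of_prefix {G : SASGame V} {v : V} {σ : Strat V} {l m : List V}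
    (hc : G.Consistent v σ m) (h : l <+: m) (hne : l ≠ []) : G.Consistent v σ l := by
  induction hc with
  | root =>
    obtain ⟨t, ht⟩ := h
    cases l with
    | nil => simp at hne
    | cons a l =>
      simp only [List.cons_append, List.cons.injEq, List.append_eq_nil_iff] at ht
      obtain ⟨rfl, rfl, -⟩ := ht
      exact .root
  | snoc h' u x h1 h2 h3 ih =>
    rcases List.prefix_concat_iff.1 h with rfl | h
    · exact .snoc _ _ _ h1 h2 h3
    · exact ih h

theorem SASGame.consistent_hist {G : SASGame V} {v : V} {σ : Strat V} {p : ℕ → V}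
    (hp : p ∈ G.PlaysFrom v σ) (n : ℕ) : G.Consistent v σ (hist p (n + 1)) := by
  obtain ⟨h0, hE, hσ⟩ := hp
  induction n with
  | zero => simpa [hist, h0] using Consistent.root (G := G) (v := v) (σ := σ)
  | succ n ih =>
    rw [hist_succ p (n + 1)]
    rw [hist_succ] at ih ⊢
    exact .snoc _ _ _ ih (hE n) (hσ n)

theorem SASGame.mem_playsFrom {G : SASGame V} {v : V} {σ : Strat V} {p : ℕ → V}
    (hp : ∀ n, G.Consistent v σ (hist p (n + 1))) : p ∈ G.PlaysFrom v σ := by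
  have key : ∀ n, G.E (p n) (p (n + 1)) ∧ (p n ∈ G.V0 → p (n + 1) = σ (hist p n) (p n)) := by
    intro n
    have := hp (n + 1)
    rw [hist_succ p (n + 1), hist_succ] at this
    exact this.snoc_inv.2
  refine ⟨?_, fun n => (key n).1, fun n => (key n).2⟩
  have h0 := hp 0
  generalize hl : hist p (0 + 1) = l at h0
  cases h0 with
  | root => simpa [hist] using hl
  | snoc h u x =>
    have := congrArg List.length hl
    simp [hist_length] at this

open Classical in
/-- The weight of a step when Player 0 follows `σ` and Player 1 may pick any successor. -/
noncomputable def SASGame.weight (G : SASGame V) (σ : Strat V) (h : List V) (u x : V) : ENNReal :=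
  if u ∈ G.V0 then (if x = σ h u then 1 else 0)
  else if u ∈ G.V1 then (if G.E u x then 1 else 0)
  else G.κ u x

/-- A random, possibly finite, run continuing the history `g`, in which Player 0 follows `σ` and
Player 1 may randomize: `C h` is the event that the run extends the history `h`.
The run may end at any time. -/
structure SASGame.RandomRun (G : SASGame V) (σ : Strat V) (g : List V) {Ω : Type}
    [MeasurableSpace Ω] (P : Measure Ω) (C : List V → Set Ω) : Prop where
  meas : ∀ h, MeasurableSet (C h)
  mono : ∀ {h h'}, h <+: h' → C h' ⊆ C h
  comparable : ∀ {h h' ω}, ω ∈ C h → ω ∈ C h' → h <+: h' ∨ h' <+: h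
  root : ∀ h, C h ⊆ C g
  mass : ∀ h u x, g <+: h ++ [u] → P (C (h ++ [u] ++ [x])) ≤ G.weight σ h u x * P (C (h ++ [u]))

/-- The event that a random run is infinite and violates the parity condition induced by `q`. -/
def badEvent {α Ω : Type} (q : α → ℕ) (C : List α → Set Ω) : Set Ω :=
  {ω | ∃ p, p ∉ ParityWin q ∧ ∀ n, ω ∈ C (hist p n)}

/-- `σ` is winning from `v`, even if Player 1 may randomize, start from any consistent history,
and end the play. -/
structure SASGame.StronglyWins (G : SASGame V) (v : V) (σ : Strat V) : Prop where
  valid : G.Valid0 σ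
  sure : G.PlaysFrom v σ ⊆ ParityWin G.ps
  almostSure : ∀ g, G.Consistent v σ g → ∀ (Ω : Type) [MeasurableSpace Ω] (P : Measure Ω)
    [IsFiniteMeasure P] (C : List V → Set Ω), G.RandomRun σ g P C → P (badEvent G.pas C) = 0

/-- The plays extending a finite history. -/
def cylinderSet {α : Type*} (l : List α) : Set (ℕ → α) := {p | hist p l.length = l}

theorem measurableSet_cylinderSet {α : Type} (l : List α) :
    MeasurableSet[playMS α] (cylinderSet l) := by
  let _ : MeasurableSpace α := ⊤
  have : cylinderSet l = ⋂ i : Fin l.length, (fun p : ℕ → α => p i) ⁻¹' {l[i]} := by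
    ext p
    simp only [cylinderSet, Set.mem_ofPred_eq, Set.mem_iInter, Set.mem_preimage,
      Set.mem_singleton_iff]
    constructor
    · intro h i
      have hi : (i : ℕ) < (hist p l.length).length := by simp [hist_length]
      rw [← hist_getElem p hi]
      exact List.getElem_of_eq h hi
    · intro h
      apply List.ext_getElem
      · simp [hist_length]
      · intro i h1 h2
        rw [hist_getElem]
        exact h ⟨i, h2⟩
  rw [this]
  exact MeasurableSet.iInter fun i => (measurable_pi_apply (i : ℕ)) trivial

theorem measurableSet_parityWin (q : V → ℕ) : MeasurableSet[playMS V] (ParityWin q) := by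
  let _ : MeasurableSpace V := ⊤
  have h1 : ∀ v : V, MeasurableSet {p : ℕ → V | v ∈ InfOcc p} := by
    intro v
    have : {p : ℕ → V | v ∈ InfOcc p} =
        ⋂ n : ℕ, ⋃ m : ℕ, ⋃ _ : n ≤ m, (fun p : ℕ → V => p m) ⁻¹' {v} := by
      ext p; simp [InfOcc]
    rw [this]
    exact .iInter fun n => .iUnion fun m => .iUnion fun _ => (measurable_pi_apply m) trivial
  have h2 : ∀ S : Set V, MeasurableSet {p : ℕ → V | InfOcc p = S} := by
    intro S
    have : {p : ℕ → V | InfOcc p = S} =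
        ⋂ v : V, {p : ℕ → V | v ∈ InfOcc p ↔ v ∈ S} := by
      ext p; simp [Set.ext_iff]
    rw [this]
    refine .iInter fun v => ?_
    by_cases hv : v ∈ S
    · simpa [hv] using h1 v
    · simp only [hv, iff_false]
      exact (h1 v).compl
  have : ParityWin q =
      ⋃ S : Set V, ⋃ _ : Even (sInf (q '' S)), {p : ℕ → V | InfOcc p = S} := by
    ext p; simp [ParityWin, minPrio]
  rw [this]
  exact .iUnion fun S => .iUnion fun _ => h2 S

section PlayMeasure

variable {G : SASGame V} {v : V} {σ π : Strat V} {μ : @Measure (ℕ → V) (playMS V)}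

theorem hist_eq_iff {α : Type*} {p q : ℕ → α} {n : ℕ} :
    hist p n = hist q n ↔ ∀ i < n, p i = q i := by
  simp [hist]

theorem SASGame.IsPlayMeasure.cylinderSet_hist (hμ : G.IsPlayMeasure v σ π μ) (q : ℕ → V)
    (n : ℕ) : μ (cylinderSet (hist q (n + 1))) = G.cylProb v σ π q n := by
  rw [← hμ.2 q n]
  congr 1
  ext p
  simp only [cylinderSet, Set.mem_ofPred_eq, hist_length, hist_eq_iff, Nat.lt_succ_iff]

theorem exists_eq_hist {α : Type*} [Nonempty α] (l : List α) :
    ∃ q : ℕ → α, l = hist q l.length := by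
  refine ⟨fun i => l.getD i (Classical.arbitrary α), ?_⟩
  apply List.ext_getElem
  · simp [hist_length]
  · intro i h1 h2
    rw [hist_getElem]
    simp [h1]

theorem SASGame.IsPlayMeasure.cylinderSet_snoc (hμ : G.IsPlayMeasure v σ π μ) (h : List V)
    (u x : V) : μ (cylinderSet (h ++ [u] ++ [x])) =
      G.step σ π h u x * μ (cylinderSet (h ++ [u])) := by
  have : Nonempty V := ⟨v⟩
  obtain ⟨q, hq⟩ := exists_eq_hist (h ++ [u] ++ [x])
  have hlen : (h ++ [u] ++ [x]).length = h.length + 1 + 1 := by simp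
  rw [hlen, hist_succ] at hq
  obtain ⟨h1, h2⟩ := List.append_inj' hq rfl
  rw [hist_succ] at h1
  obtain ⟨h3, h4⟩ := List.append_inj' h1 rfl
  simp only [List.cons.injEq, and_true] at h2 h4
  rw [hq, ← hist_succ, h1, ← hist_succ, hμ.cylinderSet_hist, hμ.cylinderSet_hist,
    SASGame.cylProb, SASGame.cylProb, Finset.prod_range_succ, ← h3, ← h4, ← h2]
  ring

theorem SASGame.IsPlayMeasure.cylinderSet_root (hμ : G.IsPlayMeasure v σ π μ) :
    μ (cylinderSet [v]) = 1 := by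
  have := hμ.cylinderSet_hist (fun _ => v) 0
  simpa [SASGame.cylProb, hist] using this

end PlayMeasure

/-! ### Merging strategies -/

/-- The state of the merged strategy: whether the current configuration is the hub, which
subplay is being continued, and the histories of all subplays. -/
structure MergeState (α : Type*) where
  atHub : Prop
  mode : α
  mem : α → List α

open Classical in
/-- At the hub, the choice of the successor determines the subplay that is continued. -/
noncomputable def MergeState.step {α : Type*} (hub : α) (s : MergeState α) (x : α) :
    MergeState α :=
  let m := if s.atHub then x else s.mode
  ⟨x = hub, m, Function.update s.mem m (s.mem m ++ [x])⟩

/-- The state after a finite history. -/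
noncomputable def mergeRun {α : Type*} (hub : α) (s : MergeState α) (l : List α) : MergeState α :=
  l.foldl (MergeState.step hub) s

section Merge

variable {α : Type*} {hub : α} {s : MergeState α}

theorem mergeRun_snoc (l : List α) (x : α) :
    mergeRun hub s (l ++ [x]) = (mergeRun hub s l).step hub x := by
  simp [mergeRun]

theorem mergeRun_atHub (l : List α) (x : α) :
    (mergeRun hub s (l ++ [x])).atHub ↔ x = hub := by
  rw [mergeRun_snoc]; rfl

theorem mergeRun_mode_hub (l : List α) (x : α) :
    (mergeRun hub s (l ++ [hub] ++ [x])).mode = x := by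
  rw [mergeRun_snoc]
  exact if_pos ((mergeRun_atHub l hub).2 rfl)

theorem mergeRun_mode_of_ne (l : List α) {u : α} (hu : u ≠ hub) (x : α) :
    (mergeRun hub s (l ++ [u] ++ [x])).mode = (mergeRun hub s (l ++ [u])).mode := by
  rw [mergeRun_snoc]
  exact if_neg (fun h => hu ((mergeRun_atHub l u).1 h))

theorem mergeRun_mem_mode (l : List α) {x w : α} (h : (mergeRun hub s (l ++ [x])).mode = w) :
    (mergeRun hub s (l ++ [x])).mem w = (mergeRun hub s l).mem w ++ [x] := by
  subst h
  simp only [mergeRun_snoc, MergeState.step, Function.update_self]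

theorem mergeRun_mem_of_ne (l : List α) {x w : α} (h : (mergeRun hub s (l ++ [x])).mode ≠ w) :
    (mergeRun hub s (l ++ [x])).mem w = (mergeRun hub s l).mem w := by
  classical
  rw [mergeRun_snoc] at h ⊢
  exact Function.update_of_ne h.symm ..

theorem mergeRun_mem_snoc_prefix (l : List α) (x w : α) :
    (mergeRun hub s l).mem w <+: (mergeRun hub s (l ++ [x])).mem w := by
  by_cases h : (mergeRun hub s (l ++ [x])).mode = w
  · rw [mergeRun_mem_mode l h]; exact List.prefix_append _ _
  · rw [mergeRun_mem_of_ne l h]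

theorem mergeRun_mem_mono {l l' : List α} (h : l <+: l') (w : α) :
    (mergeRun hub s l).mem w <+: (mergeRun hub s l').mem w := by
  obtain ⟨t, rfl⟩ := h
  induction t using List.reverseRecOn with
  | nil => simp
  | append_singleton t x ih =>
    rw [← List.append_assoc]
    exact ih.trans (mergeRun_mem_snoc_prefix _ x w)

/-- Every entry of a subplay was appended at some step of the merged history. -/
theorem mergeRun_mem_descend {g t l : List α} {x w : α} (hl : (mergeRun hub s g).mem w <+: l)
    (h : l ++ [x] <+: (mergeRun hub s (g ++ t)).mem w) :
    ∃ t', g ++ t' ++ [x] <+: g ++ t ∧ (mergeRun hub s (g ++ t')).mem w = l ∧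
      (mergeRun hub s (g ++ t' ++ [x])).mode = w := by
  induction t using List.reverseRecOn with
  | nil =>
    have h1 := hl.length_le
    have h2 := h.length_le
    simp at h2
    omega
  | append_singleton t y ih =>
    rw [← List.append_assoc] at h ⊢
    have key : l ++ [x] <+: (mergeRun hub s (g ++ t)).mem w →
        ∃ t', g ++ t' ++ [x] <+: g ++ t ++ [y] ∧ (mergeRun hub s (g ++ t')).mem w = l ∧
          (mergeRun hub s (g ++ t' ++ [x])).mode = w := by
      intro h
      obtain ⟨t', h1, h2⟩ := ih h
      exact ⟨t', h1.trans (List.prefix_append _ _), h2⟩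
    by_cases hm : (mergeRun hub s (g ++ t ++ [y])).mode = w
    · rw [mergeRun_mem_mode _ hm] at h
      rcases List.prefix_concat_iff.1 h with h | h
      · obtain ⟨rfl, hx⟩ := List.append_inj' h rfl
        simp only [List.cons.injEq, and_true] at hx
        subst hx
        exact ⟨t, List.prefix_rfl, rfl, hm⟩
      · exact key h
    · rw [mergeRun_mem_of_ne _ hm] at h
      exact key h

/-- The current subplay ends in the current configuration and the others end in the hub. -/
theorem mergeRun_last (h0 : ¬ s.atHub) (hs : ∀ w, w ≠ s.mode → ∃ h, s.mem w = h ++ [hub])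
    (l : List α) (x : α) :
    (∃ h, (mergeRun hub s (l ++ [x])).mem (mergeRun hub s (l ++ [x])).mode = h ++ [x]) ∧
      ∀ w, w ≠ (mergeRun hub s (l ++ [x])).mode →
        ∃ h, (mergeRun hub s (l ++ [x])).mem w = h ++ [hub] := by
  refine ⟨⟨_, mergeRun_mem_mode l rfl⟩, ?_⟩
  induction l using List.reverseRecOn generalizing x with
  | nil =>
    intro w hw
    rw [mergeRun_mem_of_ne _ hw.symm]
    refine hs w (fun h => hw ?_)
    rw [h]
    exact (if_neg h0).symm
  | append_singleton l u ih =>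
    intro w hw
    rw [mergeRun_mem_of_ne _ hw.symm]
    by_cases hu : w = (mergeRun hub s (l ++ [u])).mode
    · subst hu
      by_cases huh : u = hub
      · subst huh
        exact ⟨_, mergeRun_mem_mode l rfl⟩
      · exact absurd (mergeRun_mode_of_ne l huh x).symm hw
    · exact ih u w hu

/-- If a play violates a parity condition, then so does one of its infinite subplays. -/
theorem exists_subplay_not_mem_parityWin [Finite α] {q : α → ℕ} {p : ℕ → α}
    (hp : p ∉ ParityWin q) :
    ∃ w, ∃ p', p' ∉ ParityWin q ∧
      (∀ n, ∃ N, hist p' n <+: (mergeRun hub s (hist p N)).mem w) ∧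
      ∃ N, (mergeRun hub s (hist p (N + 1))).mode = w := by
  cases nonempty_fintype α
  have : Nonempty α := ⟨p 0⟩
  have hne : (InfOcc p).Nonempty := by
    by_contra hcon
    rw [Set.not_nonempty_iff_eq_empty] at hcon
    have : ∀ v, ∃ n, ∀ m, n ≤ m → p m ≠ v := by
      intro v
      have hv : v ∉ InfOcc p := by simp [hcon]
      simpa [InfOcc] using hv
    choose N hN using this
    exact hN (p (Finset.univ.sup N)) (Finset.univ.sup N)
      (Finset.le_sup (f := N) (Finset.mem_univ _)) rfl
  obtain ⟨x, hx, hqx⟩ : minPrio q p ∈ q '' InfOcc p := Nat.sInf_mem (hne.image q)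
  obtain ⟨w, hw⟩ : ∃ w, ∀ n, ∃ m, n ≤ m ∧ p m = x ∧
      (mergeRun hub s (hist p (m + 1))).mode = w := by
    by_contra! hcon
    choose N hN using hcon
    obtain ⟨m, hm, hpm⟩ := hx (Finset.univ.sup N)
    exact hN _ m ((Finset.le_sup (f := N) (Finset.mem_univ _)).trans hm) hpm rfl
  have hstep : ∀ n, (mergeRun hub s (hist p (n + 1))).mode = w →
      (mergeRun hub s (hist p (n + 1))).mem w = (mergeRun hub s (hist p n)).mem w ++ [p n] := by
    intro n hn
    rw [hist_succ] at hn ⊢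
    exact mergeRun_mem_mode _ hn
  have hmono : ∀ {m n}, m ≤ n →
      (mergeRun hub s (hist p m)).mem w <+: (mergeRun hub s (hist p n)).mem w :=
    fun h => mergeRun_mem_mono (hist_prefix p h) w
  have hunb : ∀ k, ∃ n, k < ((mergeRun hub s (hist p n)).mem w).length := by
    intro k
    induction k with
    | zero =>
      obtain ⟨m, -, -, hm⟩ := hw 0
      exact ⟨m + 1, by simp [hstep m hm]⟩
    | succ k ih =>
      obtain ⟨n, hn⟩ := ih
      obtain ⟨m, hnm, -, hm⟩ := hw n
      have := (hmono hnm).length_le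
      exact ⟨m + 1, by simp [hstep m hm]; omega⟩
  obtain ⟨p', hp'⟩ := exists_limit_of_chain _ (fun n => hmono n.le_succ) hunb
  have hval : ∀ n, (mergeRun hub s (hist p (n + 1))).mode = w →
      p' ((mergeRun hub s (hist p n)).mem w).length = p n := by
    intro n hn
    have h1 := hp' (n + 1)
    rw [hstep n hn, List.length_append, List.length_singleton, hist_succ] at h1
    simpa using ((List.append_inj' h1 rfl).2).symm
  refine ⟨w, p', ?_, ?_, ?_⟩
  · have h1 : x ∈ InfOcc p' := by
      intro n
      obtain ⟨N, hN⟩ := hunb n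
      obtain ⟨m, hNm, hpm, hm⟩ := hw N
      exact ⟨_, hN.le.trans (hmono hNm).length_le, (hval m hm).trans hpm⟩
    have h2 : InfOcc p' ⊆ InfOcc p := by
      classical
      intro y hy n
      obtain ⟨m, hnm, hm⟩ := hy ((mergeRun hub s (hist p n)).mem w).length
      have hk := Nat.find_spec (hunb m)
      have hmin := fun k => Nat.find_min (hunb m) (m := k)
      generalize Nat.find (hunb m) = k at hk hmin
      have hnk : n < k := by
        by_contra hcon
        have := (hmono (not_lt.1 hcon)).length_le
        omega
      obtain ⟨k, rfl⟩ : ∃ j, k = j + 1 := ⟨k - 1, by omega⟩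
      have hk' := hmin k k.lt_succ_self
      by_cases hmode : (mergeRun hub s (hist p (k + 1))).mode = w
      · refine ⟨k, by omega, ?_⟩
        have h3 := hval k hmode
        rw [hstep k hmode] at hk
        simp only [List.length_append, List.length_singleton] at hk
        rw [← h3, ← hm]
        congr 1
        omega
      · rw [hist_succ] at hmode hk
        rw [mergeRun_mem_of_ne _ hmode] at hk
        exact absurd hk hk'
    have h3 : minPrio q p' = minPrio q p := by
      apply le_antisymm
      · rw [← hqx]; exact Nat.sInf_le ⟨x, h1, rfl⟩
      · obtain ⟨y, hy, hqy⟩ : minPrio q p' ∈ q '' InfOcc p' := Nat.sInf_mem ⟨_, x, h1, rfl⟩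
        rw [← hqy]
        exact Nat.sInf_le ⟨y, h2 hy, rfl⟩
    intro h
    exact hp (by simpa only [ParityWin, Set.mem_ofPred_eq, h3] using h)
  · intro n
    obtain ⟨N, hN⟩ := hunb n
    refine ⟨N, ?_⟩
    rw [hp' N]
    exact hist_prefix _ hN.le
  · obtain ⟨N, -, -, hN⟩ := hw 0
    exact ⟨N, hN⟩

end Merge

/-! ### Strong winning and winning -/

theorem cylinderSet_anti {α : Type*} {l l' : List α} (h : l <+: l') :
    cylinderSet l' ⊆ cylinderSet l := by
  intro p hp
  rw [cylinderSet, Set.mem_ofPred_eq] at hp ⊢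
  rw [← hp] at h
  exact (eq_hist_of_prefix h).symm

theorem mem_cylinderSet_hist {α : Type*} (p : ℕ → α) (n : ℕ) : p ∈ cylinderSet (hist p n) := by
  simp [cylinderSet, hist_length]

theorem prefix_or_prefix_of_mem_cylinderSet {α : Type*} {l l' : List α} {p : ℕ → α}
    (h : p ∈ cylinderSet l) (h' : p ∈ cylinderSet l') : l <+: l' ∨ l' <+: l := by
  rw [cylinderSet, Set.mem_ofPred_eq] at h h'
  rw [← h, ← h']
  exact (le_total l.length l'.length).imp (hist_prefix p) (hist_prefix p)

theorem SASGame.step_le_weight {G : SASGame V} {σ π : Strat V} (hπ : G.Valid1 π) (h : List V)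
    (u x : V) : G.step σ π h u x ≤ G.weight σ h u x := by
  unfold SASGame.step SASGame.weight
  split_ifs with h0 _ h1 h2 h3
  all_goals first | exact le_rfl | exact zero_le | skip
  exact absurd (h2 ▸ hπ h u h1) h3

theorem SASGame.StronglyWins.wins0 {G : SASGame V} {v : V} {σ : Strat V}
    (hσ : G.StronglyWins v σ) : G.Wins0 v := by
  refine ⟨σ, hσ.valid, hσ.sure, fun π hπ μ hμ => ?_⟩
  let _ : MeasurableSpace (ℕ → V) := playMS V
  have : IsProbabilityMeasure μ := ⟨hμ.1⟩
  have hsub : ∀ {h : List V}, [v] <+: h → cylinderSet h ∩ cylinderSet [v] = cylinderSet h :=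
    fun h => Set.inter_eq_left.2 (cylinderSet_anti h)
  have hrun : G.RandomRun σ [v] μ fun h => cylinderSet h ∩ cylinderSet [v] :=
    { meas := fun h => (measurableSet_cylinderSet h).inter (measurableSet_cylinderSet [v])
      mono := fun h => Set.inter_subset_inter_left _ (cylinderSet_anti h)
      comparable := fun h h' => prefix_or_prefix_of_mem_cylinderSet h.1 h'.1
      root := fun h => by simp
      mass := fun h u x hg => by
        rw [hsub hg, hsub (hg.trans (List.prefix_append _ _)), hμ.cylinderSet_snoc]
        exact mul_le_mul_left (step_le_weight hπ h u x) _ }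
  have h0 := hσ.almostSure [v] .root _ μ _ hrun
  have h1 : μ (cylinderSet [v])ᶜ = 0 :=
    (prob_compl_eq_zero_iff (measurableSet_cylinderSet [v])).2 hμ.cylinderSet_root
  rw [← prob_compl_eq_zero_iff (measurableSet_parityWin G.pas)]
  refine measure_mono_null (fun p hp => ?_) (measure_union_null h0 h1)
  by_cases hv : p ∈ cylinderSet [v]
  · exact Or.inl ⟨p, hp, fun n => ⟨mem_cylinderSet_hist p n, hv⟩⟩
  · exact Or.inr hv

/-! ### Games in which Player 1 has no choice -/

theorem exists_minimal_hist {α : Type*} {p : ℕ → α} {S : Set (List α)}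
    (h : ∃ n, hist p n ∈ S) :
    ∃ n, hist p n ∈ S ∧ ∀ l, l <+: hist p n → l ∈ S → l = hist p n := by
  classical
  refine ⟨Nat.find h, Nat.find_spec h, fun l hl hS => ?_⟩
  have h1 := eq_hist_of_prefix hl
  have h2 := hl.length_le
  rw [hist_length] at h2
  rw [h1] at hS
  rw [h1, le_antisymm h2 (Nat.find_min' h hS)]

/-- A random run whose masses are dominated by a measure on plays almost surely avoids the
null sets of this measure. -/
theorem SASGame.RandomRun.measure_eq_zero {G : SASGame V} {σ : Strat V} {g : List V} {Ω : Type}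
    [MeasurableSpace Ω] {P : Measure Ω} {C : List V → Set Ω} (hC : G.RandomRun σ g P C)
    {μ : @Measure (ℕ → V) (playMS V)} [IsFiniteMeasure μ] {c : ENNReal} (hc : c ≠ ⊤)
    (hle : ∀ h, g <+: h → P (C h) ≤ c * μ (cylinderSet h)) {B : Set (ℕ → V)} (hB : μ B = 0) :
    P {ω | ∃ p ∈ B, ∀ n, ω ∈ C (hist p n)} = 0 := by
  let _ : MeasurableSpace V := ⊤
  let _ : TopologicalSpace V := ⊥
  have : DiscreteTopology V := ⟨rfl⟩
  have : BorelSpace V := ⟨borel_eq_top_of_discrete.symm⟩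
  have hle' : ∀ h, g.length ≤ h.length → P (C h) ≤ c * μ (cylinderSet h) := by
    intro h hlen
    rcases (C h).eq_empty_or_nonempty with he | ⟨ω, hω⟩
    · simp [he]
    · refine hle h ?_
      rcases hC.comparable hω (hC.root h hω) with h1 | h1
      · rw [h1.eq_of_length (le_antisymm h1.length_le hlen)]
      · exact h1
  have key : ∀ ε : ENNReal, 0 < ε → P {ω | ∃ p ∈ B, ∀ n, ω ∈ C (hist p n)} ≤ c * ε := by
    intro ε hε
    obtain ⟨U, hBU, hU, hμU⟩ : ∃ U, B ⊆ U ∧ IsOpen U ∧ μ U < ε := by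
      let ν : @Measure (ℕ → V) MeasurableSpace.pi := μ
      have : IsFiniteMeasure ν := ‹IsFiniteMeasure μ›
      obtain ⟨U, hBU, hU, hνU⟩ := B.exists_isOpen_lt_of_lt (μ := ν) ε (hB.trans_lt hε)
      exact ⟨U, hBU, hU, hνU⟩
    let S : Set (List V) := {h | g.length ≤ h.length ∧ cylinderSet h ⊆ U}
    let M : Set (List V) := {h | h ∈ S ∧ ∀ l, l <+: h → l ∈ S → l = h}
    have hcover : {ω | ∃ p ∈ B, ∀ n, ω ∈ C (hist p n)} ⊆ ⋃ h ∈ M, C h := by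
      rintro ω ⟨p, hp, hω⟩
      have hex : ∃ n, hist p n ∈ S := by
        obtain ⟨I, u, hu, hIU⟩ := isOpen_pi_iff.1 hU p (hBU hp)
        refine ⟨max g.length (I.sup id + 1), by simp [hist_length], fun p' hp' => hIU ?_⟩
        intro i hi
        have hi' : i ≤ I.sup id := Finset.le_sup (f := id) hi
        rw [cylinderSet, Set.mem_ofPred_eq, hist_length, hist_eq_iff] at hp'
        rw [hp' i (lt_max_of_lt_right (Nat.lt_succ_iff.2 hi'))]
        exact (hu i hi).2
      obtain ⟨n, hn⟩ := exists_minimal_hist hex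
      exact Set.mem_biUnion (show hist p n ∈ M from hn) (hω n)
    have hdisj : M.PairwiseDisjoint cylinderSet := by
      intro h hh h' hh' hne
      refine Set.disjoint_left.2 fun p hp hp' => hne ?_
      rcases prefix_or_prefix_of_mem_cylinderSet hp hp' with h1 | h1
      · exact hh'.2 _ h1 hh.1
      · exact (hh.2 _ h1 hh'.1).symm
    calc P {ω | ∃ p ∈ B, ∀ n, ω ∈ C (hist p n)}
        ≤ P (⋃ h ∈ M, C h) := measure_mono hcover
      _ ≤ ∑' h : M, P (C h) := measure_biUnion_le P M.to_countable C
      _ ≤ ∑' h : M, c * μ (cylinderSet h.1) := ENNReal.tsum_le_tsum fun h => hle' h h.2.1.1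
      _ = c * μ (⋃ h ∈ M, cylinderSet h) := by
        rw [ENNReal.tsum_mul_left, measure_biUnion M.to_countable hdisj
          fun h _ => measurableSet_cylinderSet h]
      _ ≤ c * ε := by
        gcongr
        exact (measure_mono (Set.iUnion₂_subset fun h hh => hh.1.2)).trans hμU.le
  refine le_antisymm (ENNReal.le_of_forall_pos_le_add fun ε hε _ => ?_) zero_le
  have h1 := key (ε / c) (ENNReal.div_pos (by simpa using hε.ne') hc)
  rw [zero_add]
  exact h1.trans ENNReal.mul_div_le

theorem SASGame.IsPlayMeasure.pos_of_consistent {G : SASGame V} {v : V} {σ π : Strat V}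
    {μ : @Measure (ℕ → V) (playMS V)} (hμ : G.IsPlayMeasure v σ π μ)
    (huniq : ∀ h u x, u ∈ G.V1 → G.E u x → x = π h u) {g : List V} (hg : G.Consistent v σ g) :
    0 < μ (cylinderSet g) := by
  induction hg with
  | root => rw [hμ.cylinderSet_root]; exact one_pos
  | snoc h u x _ hE hσ ih =>
    rw [hμ.cylinderSet_snoc]
    refine ENNReal.mul_pos (pos_iff_ne_zero.1 ?_) ih.ne'
    unfold SASGame.step
    by_cases h0 : u ∈ G.V0
    · rw [if_pos h0, if_pos (hσ h0)]; exact one_pos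
    by_cases h1 : u ∈ G.V1
    · rw [if_neg h0, if_pos h1, if_pos (huniq h u x h1 hE)]; exact one_pos
    rw [if_neg h0, if_neg h1]
    have hp : u ∈ G.V0 ∪ G.V1 ∪ G.Vp := by rw [G.cover]; trivial
    exact (G.κ_pos u (hp.resolve_left (by simp [h0, h1])) x).2 hE

theorem SASGame.determined_of_subsingleton_choice {G : SASGame V}
    (huniq : ∀ u ∈ G.V1, ∀ x y, G.E u x → G.E u y → x = y) (v : V) :
    (∃ σ, G.StronglyWins v σ) ∨ G.Wins1 v := by
  choose f hf using G.succ_nonempty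
  have hfu : ∀ (h : List V) u x, u ∈ G.V1 → G.E u x → x = (fun _ u => f u : Strat V) h u :=
    fun _ u x hu hE => huniq u hu x (f u) hE (hf u)
  rw [or_iff_not_imp_left]
  intro hno
  refine ⟨fun _ u => f u, fun _ u _ => hf u, fun σ hσ => ?_⟩
  by_cases hsure : G.PlaysFrom v σ ⊆ ParityWin G.ps
  swap
  · obtain ⟨p, hp, hps⟩ := Set.not_subset.1 hsure
    exact Or.inl ⟨p, ⟨hp, fun n hn => hfu (hist p n) _ _ hn (hp.2.1 n)⟩, hps⟩
  right
  intro μ hμ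
  have : IsProbabilityMeasure μ := ⟨hμ.1⟩
  refine lt_of_le_of_ne prob_le_one fun hone => hno ⟨σ, hσ, hsure, ?_⟩
  intro g hg Ω _ P _ C hC
  rw [← prob_compl_eq_zero_iff (measurableSet_parityWin G.pas)] at hone
  have hpos := hμ.pos_of_consistent hfu hg
  refine hC.measure_eq_zero (c := P (C g) / μ (cylinderSet g))
    (ENNReal.div_ne_top (measure_ne_top _ _) hpos.ne') ?_ hone
  rintro h ⟨t, rfl⟩
  induction t using List.reverseRecOn with
  | nil =>
    rw [List.append_nil, ENNReal.div_mul_cancel hpos.ne' (measure_ne_top _ _)]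
  | append_singleton t x ih =>
    obtain ⟨l, u, hl⟩ : ∃ l u, g ++ t = l ++ [u] :=
      ⟨_, _, (List.dropLast_append_getLast (by simp [hg.ne_nil])).symm⟩
    have hgl : g <+: l ++ [u] := hl ▸ List.prefix_append g t
    rw [← List.append_assoc]
    rw [hl] at ih ⊢
    rw [hμ.cylinderSet_snoc, mul_left_comm]
    refine (hC.mass l u x hgl).trans (mul_le_mul' ?_ ih)
    unfold SASGame.step SASGame.weight
    split_ifs with h0 _ h1 h2 h3
    all_goals first | exact le_rfl | exact zero_le | skip
    exact absurd (hfu l u x h1 h2) h3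

/-! ### Removing the choice of Player 1 at a configuration -/

/-- The game in which Player 1 has to move from `a` to `w`. -/
def SASGame.restrict (G : SASGame V) {a w : V} (ha : a ∈ G.V1) (hw : G.E a w) : SASGame V where
  V0 := G.V0
  V1 := G.V1
  Vp := G.Vp
  cover := G.cover
  disj01 := G.disj01
  disj0p := G.disj0p
  disj1p := G.disj1p
  E := fun u x => G.E u x ∧ (u = a → x = w)
  succ_nonempty := fun u => by
    by_cases hu : u = a
    · exact ⟨w, hu ▸ hw, fun _ => rfl⟩
    · obtain ⟨x, hx⟩ := G.succ_nonempty u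
      exact ⟨x, hx, fun h => absurd h hu⟩
  κ := G.κ
  κ_pos := fun u hu x => by
    have hne : u ≠ a := fun h => Set.disjoint_left.1 G.disj1p ha (h ▸ hu)
    simpa [hne] using G.κ_pos u hu x
  κ_sum := G.κ_sum
  ps := G.ps
  pas := G.pas

theorem SASGame.Wins1.of_restrict {G : SASGame V} {a w : V} {ha : a ∈ G.V1} {hw : G.E a w} {v : V}
    (h : (G.restrict ha hw).Wins1 v) : G.Wins1 v := by
  obtain ⟨π, hπ, hwin⟩ := h
  refine ⟨π, fun h u hu => (hπ h u hu).1, fun σ hσ => ?_⟩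
  have hσ' : (G.restrict ha hw).Valid0 σ := fun h u hu =>
    ⟨hσ h u hu, fun hua => absurd ha (Set.disjoint_left.1 G.disj01 (hua ▸ hu))⟩
  rcases hwin σ hσ' with ⟨p, ⟨⟨h1, h2, h3⟩, h4⟩, h5⟩ | hμ
  · exact Or.inl ⟨p, ⟨⟨h1, fun n => (h2 n).1, h3⟩, h4⟩, h5⟩
  · exact Or.inr hμ

theorem SASGame.weight_restrict {G : SASGame V} {a w : V} (ha : a ∈ G.V1) (hw : G.E a w)
    (σ : Strat V) (h : List V) {u : V} (hu : u ≠ a) (x : V) :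
    (G.restrict ha hw).weight σ h u x = G.weight σ h u x := by
  have hE : (G.restrict ha hw).E u x ↔ G.E u x := ⟨And.left, fun h => ⟨h, fun e => absurd e hu⟩⟩
  unfold SASGame.weight
  rw [hE]
  rfl

theorem SASGame.RandomRun.consistent {G : SASGame V} {v : V} {σ : Strat V} {g : List V} {Ω : Type}
    [MeasurableSpace Ω] {P : Measure Ω} {C : List V → Set Ω} (hC : G.RandomRun σ g P C)
    (hσ : G.Valid0 σ) (hg : G.Consistent v σ g) {l : List V} (hgl : g <+: l) (hl : P (C l) ≠ 0) :
    G.Consistent v σ l := by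
  obtain ⟨t, rfl⟩ := hgl
  induction t using List.reverseRecOn with
  | nil => simpa using hg
  | append_singleton t x ih =>
    obtain ⟨h, u, hhu⟩ : ∃ h u, g ++ t = h ++ [u] :=
      ⟨_, _, (List.dropLast_append_getLast (by simp [hg.ne_nil])).symm⟩
    have hgl : g <+: h ++ [u] := hhu ▸ List.prefix_append g t
    rw [← List.append_assoc] at hl ⊢
    rw [hhu] at hl ih ⊢
    have hne : G.weight σ h u x * P (C (h ++ [u])) ≠ 0 := fun h0 =>
      hl (le_antisymm ((hC.mass h u x hgl).trans h0.le) zero_le)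
    obtain ⟨hweight, hP⟩ := mul_ne_zero_iff.1 hne
    unfold SASGame.weight at hweight
    by_cases h0 : u ∈ G.V0
    · have hx : x = σ h u := by by_contra hcon; simp [h0, hcon] at hweight
      exact .snoc _ _ _ (ih hP) (hx ▸ hσ h u h0) fun _ => hx
    by_cases h1 : u ∈ G.V1
    · have hE : G.E u x := by by_contra hcon; simp [h0, h1, hcon] at hweight
      exact .snoc _ _ _ (ih hP) hE fun h => absurd h h0
    rw [if_neg h0, if_neg h1] at hweight
    have hp : u ∈ G.V0 ∪ G.V1 ∪ G.Vp := by rw [G.cover]; trivial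
    exact .snoc _ _ _ (ih hP)
      ((G.κ_pos u (hp.resolve_left (by simp [h0, h1])) x).1 (pos_iff_ne_zero.2 hweight))
      fun h => absurd h h0

/-- A strategy that is winning in a restricted game and avoids the configuration at which the
game is restricted is winning in the full game. -/
theorem SASGame.StronglyWins.of_restrict {G : SASGame V} {a w v : V} {ha : a ∈ G.V1}
    {hw : G.E a w} {σ : Strat V} (hσ : (G.restrict ha hw).StronglyWins v σ)
    (havoid : ∀ h, ¬ (G.restrict ha hw).Consistent v σ (h ++ [a])) : G.StronglyWins v σ := by
  have hcons : ∀ {l}, G.Consistent v σ l → (G.restrict ha hw).Consistent v σ l := by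
    intro l hl
    induction hl with
    | root => exact .root
    | snoc h u x _ hE hs ih =>
      exact .snoc _ _ _ ih ⟨hE, fun hua => absurd (hua ▸ ih) (havoid h)⟩ hs
  have hvalid : G.Valid0 σ := fun h u hu => (hσ.valid h u hu).1
  refine ⟨hvalid, fun p hp => hσ.sure (mem_playsFrom fun n => hcons (consistent_hist hp n)), ?_⟩
  intro g hg Ω _ P _ C hC
  refine hσ.almostSure g (hcons hg) Ω P C ⟨hC.meas, hC.mono, hC.comparable, hC.root, ?_⟩
  intro h u x hgl
  by_cases hu : u = a
  · subst hu
    have h0 : P (C (h ++ [u])) = 0 := by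
      by_contra hne
      exact havoid h (hcons (hC.consistent hvalid hg hgl hne))
    exact (measure_mono_null (hC.mono (List.prefix_append _ _)) h0).trans_le zero_le
  · rw [weight_restrict ha hw σ h hu]
    exact hC.mass h u x hgl

/-- The strategy continuing the current subplay with the strategy belonging to it. -/
noncomputable def mergedStrat {α : Type} (hub : α) (s : MergeState α) (σ : α → Strat α) : Strat α :=
  fun h u => σ (mergeRun hub s (h ++ [u])).mode
    ((mergeRun hub s (h ++ [u])).mem (mergeRun hub s (h ++ [u])).mode).dropLast u

/-- Initial states from which strategies for the games restricted at `a` can be merged. -/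
structure SASGame.Mergeable (G : SASGame V) {a : V} (ha : a ∈ G.V1) (v : V) (σ : V → Strat V)
    (s : MergeState V) : Prop where
  not_atHub : ¬ s.atHub
  edge : G.E a s.mode
  mem_mode : s.mem s.mode = []
  mem_of_ne : ∀ w, w ≠ s.mode → ∃ h, s.mem w = h ++ [a]
  consistent : ∀ w (hw : G.E a w), w ≠ s.mode →
    (G.restrict ha hw).Consistent v (σ w) (s.mem w)

section Merging

variable {G : SASGame V} {a v : V} {ha : a ∈ G.V1} {σ : V → Strat V} {s : MergeState V}

theorem SASGame.Mergeable.consistent_mem (hs : G.Mergeable ha v σ s) {l : List V}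
    (hl : G.Consistent v (mergedStrat a s σ) l) :
    G.E a (mergeRun a s l).mode ∧ ∀ w (hw : G.E a w),
      (G.restrict ha hw).Consistent v (σ w) ((mergeRun a s l).mem w) := by
  induction hl with
  | root =>
    have hm : (mergeRun a s ([] ++ [v])).mode = s.mode := if_neg hs.not_atHub
    refine ⟨hm ▸ hs.edge, fun w hw => ?_⟩
    change Consistent _ _ _ ((mergeRun a s ([] ++ [v])).mem w)
    by_cases hws : s.mode = w
    · subst hws
      rw [mergeRun_mem_mode [] hm]
      change Consistent _ _ _ (s.mem s.mode ++ [v])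
      rw [hs.mem_mode]
      exact .root
    · rw [mergeRun_mem_of_ne [] (hm ▸ hws)]
      exact hs.consistent w hw (Ne.symm hws)
  | snoc h u x _ hE hσ ih =>
    obtain ⟨ihE, ih⟩ := ih
    obtain ⟨hlast, hlast'⟩ := mergeRun_last hs.not_atHub hs.mem_of_ne h u
    by_cases hu : u = a
    · subst hu
      have hm := mergeRun_mode_hub (s := s) h (hub := u) x
      refine ⟨by rwa [hm], fun w hw => ?_⟩
      by_cases hxw : x = w
      · subst hxw
        rw [mergeRun_mem_mode _ hm]
        have ihx := ih x hw
        obtain ⟨k, hk⟩ : ∃ k, (mergeRun u s (h ++ [u])).mem x = k ++ [u] := by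
          by_cases hx : x = (mergeRun u s (h ++ [u])).mode
          · rw [hx]; exact hlast
          · exact hlast' x hx
        rw [hk] at ihx ⊢
        exact .snoc _ _ _ ihx ⟨hE, fun _ => rfl⟩
          fun h0 => absurd ha (Set.disjoint_left.1 G.disj01 h0)
      · rw [mergeRun_mem_of_ne _ (by rwa [hm])]
        exact ih w hw
    · have hm := mergeRun_mode_of_ne (s := s) h hu x
      refine ⟨hm ▸ ihE, fun w hw => ?_⟩
      by_cases hmw : (mergeRun a s (h ++ [u])).mode = w
      · subst hmw
        rw [mergeRun_mem_mode _ hm]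
        have ihw := ih _ hw
        obtain ⟨k, hk⟩ := hlast
        simp only [mergedStrat, hk, List.dropLast_concat] at hσ
        rw [hk] at ihw ⊢
        exact .snoc _ _ _ ihw ⟨hE, fun h => absurd h hu⟩ hσ
      · rw [mergeRun_mem_of_ne _ (hm ▸ hmw)]
        exact ih w hw

theorem SASGame.Mergeable.randomRun (hs : G.Mergeable ha v σ s) {g : List V} (hg : g ≠ [])
    {Ω : Type} [MeasurableSpace Ω] {P : Measure Ω} {C : List V → Set Ω}
    (hC : G.RandomRun (mergedStrat a s σ) g P C) {w : V} (hw : G.E a w) :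
    (G.restrict ha hw).RandomRun (σ w) ((mergeRun a s g).mem w) P
      fun h => {ω | ∃ l, ω ∈ C l ∧ h <+: (mergeRun a s l).mem w} := by
  have hmono : ∀ {h h' : List V}, h <+: h' →
      {ω | ∃ l, ω ∈ C l ∧ h' <+: (mergeRun a s l).mem w} ⊆
        {ω | ∃ l, ω ∈ C l ∧ h <+: (mergeRun a s l).mem w} := by
    rintro h h' hh ω ⟨l, hl, hhl⟩
    exact ⟨l, hl, hh.trans hhl⟩
  have hdescend : ∀ {h : List V} {x : V} {ω : Ω}, (mergeRun a s g).mem w <+: h →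
      (∃ l, ω ∈ C l ∧ h ++ [x] <+: (mergeRun a s l).mem w) →
      ∃ l, g <+: l ∧ ω ∈ C (l ++ [x]) ∧ (mergeRun a s l).mem w = h ∧
        (mergeRun a s (l ++ [x])).mode = w := by
    rintro h x ω hgh ⟨l, hl, hhl⟩
    obtain ⟨t, ht, htl⟩ : ∃ t, h ++ [x] <+: (mergeRun a s (g ++ t)).mem w ∧ ω ∈ C (g ++ t) := by
      rcases hC.comparable hl (hC.root l hl) with h1 | ⟨t, rfl⟩
      · exact ⟨[], by simpa using hhl.trans (mergeRun_mem_mono h1 w),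
          by simpa using hC.root l hl⟩
      · exact ⟨t, hhl, hl⟩
    obtain ⟨t', h1, h2, h3⟩ := mergeRun_mem_descend hgh ht
    exact ⟨g ++ t', List.prefix_append _ _, hC.mono h1 htl, h2, h3⟩
  refine ⟨fun h => ?_, hmono, ?_, fun h ω => ?_, ?_⟩
  · have : {ω | ∃ l, ω ∈ C l ∧ h <+: (mergeRun a s l).mem w} =
        ⋃ l, ⋃ _ : h <+: (mergeRun a s l).mem w, C l := by
      ext ω; simp [and_comm]
    rw [this]
    exact .iUnion fun l => .iUnion fun _ => hC.meas l
  · rintro h h' ω ⟨l, hl, hhl⟩ ⟨l', hl', hhl'⟩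
    rcases hC.comparable hl hl' with h1 | h1
    · exact List.prefix_or_prefix_of_prefix (hhl.trans (mergeRun_mem_mono h1 w)) hhl'
    · exact List.prefix_or_prefix_of_prefix hhl (hhl'.trans (mergeRun_mem_mono h1 w))
  · rintro ⟨l, hl, -⟩
    exact ⟨g, hC.root l hl, List.prefix_rfl⟩
  · intro h u x hgh
    have hlast : ∀ l, g <+: l → ∃ b y, l = b ++ [y] := fun l hl =>
      ⟨_, _, (List.dropLast_append_getLast (fun h => hg (by simpa [h] using hl))).symm⟩
    by_cases hu : u = a
    · subst hu
      by_cases hx : x = w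
      · subst hx
        have h1 : (G.restrict ha hw).weight (σ x) h u x = 1 := by
          simp [weight, restrict, ha, hw, Set.disjoint_right.1 G.disj01 ha]
        rw [h1, one_mul]
        exact measure_mono (hmono (List.prefix_append _ _))
      · refine (measure_mono_null (fun ω hω => ?_) (measure_empty (μ := P))).trans_le zero_le
        change False
        obtain ⟨l, hgl, -, hlh, hm⟩ := hdescend hgh hω
        obtain ⟨b, y, rfl⟩ := hlast l hgl
        by_cases hy : y = u
        · subst hy
          exact hx ((mergeRun_mode_hub b x).symm.trans hm)
        · rw [mergeRun_mode_of_ne b hy] at hm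
          rw [mergeRun_mem_mode b hm] at hlh
          simpa [hy] using (List.append_inj' hlh rfl).2
    · let T : Set (List V) := {l | g <+: l ∧ (mergeRun a s l).mem w = h ++ [u]}
      have hT : ∀ l ∈ T, ∃ b, l = b ++ [u] ∧ (mergeRun a s l).mode = w := by
        rintro l ⟨hgl, hlh⟩
        obtain ⟨b, y, rfl⟩ := hlast l hgl
        have hm : (mergeRun a s (b ++ [y])).mode = w := by
          by_contra hne
          obtain ⟨k, hk⟩ := (mergeRun_last hs.not_atHub hs.mem_of_ne b y).2 w (Ne.symm hne)
          rw [hlh] at hk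
          exact hu (by simpa using (List.append_inj' hk rfl).2)
        have hy := hlh
        rw [mergeRun_mem_mode b hm] at hy
        have hyu : y = u := by simpa using (List.append_inj' hy rfl).2
        exact ⟨b, by rw [hyu], hm⟩
      have hdisj : T.PairwiseDisjoint C := by
        have key : ∀ l ∈ T, ∀ l' ∈ T, l <+: l' → l = l' := by
          intro l hl l' hl' hll
          by_contra hne
          obtain ⟨y, hy⟩ := append_singleton_prefix hll hne
          obtain ⟨b, rfl, hm⟩ := hT l hl
          have h1 := (mergeRun_mem_mono (hub := a) (s := s) hy w).length_le
          rw [mergeRun_mem_mode _ ((mergeRun_mode_of_ne b hu y).trans hm), hl.2, hl'.2] at h1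
          simp at h1
        intro l hl l' hl' hne
        refine Set.disjoint_left.2 fun ω hω hω' => hne ?_
        rcases hC.comparable hω hω' with h1 | h1
        · exact key l hl l' hl' h1
        · exact (key l' hl' l hl h1).symm
      have hmass : ∀ l ∈ T, P (C (l ++ [x])) ≤ (G.restrict ha hw).weight (σ w) h u x * P (C l) := by
        intro l hl
        obtain ⟨b, rfl, hm⟩ := hT l hl
        have hσ : mergedStrat a s σ b u = σ w h u := by
          simp [mergedStrat, hm, hl.2]
        refine (hC.mass b u x hl.1).trans_eq ?_
        rw [weight_restrict ha hw _ _ hu]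
        unfold weight
        rw [hσ]
      calc P {ω | ∃ l, ω ∈ C l ∧ h ++ [u] ++ [x] <+: (mergeRun a s l).mem w}
          ≤ P (⋃ l ∈ T, C (l ++ [x])) := by
            refine measure_mono fun ω hω => ?_
            obtain ⟨l, hgl, hl, hlh, -⟩ := hdescend hgh hω
            exact Set.mem_biUnion (show l ∈ T from ⟨hgl, hlh⟩) hl
        _ ≤ ∑' l : T, P (C (l.1 ++ [x])) := measure_biUnion_le P T.to_countable _
        _ ≤ ∑' l : T, (G.restrict ha hw).weight (σ w) h u x * P (C l.1) :=
            ENNReal.tsum_le_tsum fun l => hmass l.1 l.2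
        _ = (G.restrict ha hw).weight (σ w) h u x * P (⋃ l ∈ T, C l) := by
            rw [ENNReal.tsum_mul_left, measure_biUnion T.to_countable hdisj fun l _ => hC.meas l]
        _ ≤ _ := by
            gcongr
            exact Set.iUnion₂_subset fun l hl ω hω => ⟨l, hω, hl.2 ▸ List.prefix_rfl⟩

/-- Strategies that are winning in all restricted games merge into a winning strategy. -/
theorem SASGame.Mergeable.stronglyWins (hs : G.Mergeable ha v σ s) (hvalid : ∀ w, G.Valid0 (σ w))
    (hσ : ∀ w (hw : G.E a w), (G.restrict ha hw).StronglyWins v (σ w)) :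
    G.StronglyWins v (mergedStrat a s σ) := by
  have hv : G.Valid0 (mergedStrat a s σ) := fun h u hu => hvalid _ _ u hu
  refine ⟨hv, fun p hp => ?_, ?_⟩
  · by_contra hps
    obtain ⟨w, p', hp', hsub, N, hN⟩ :=
      exists_subplay_not_mem_parityWin (hub := a) (s := s) hps
    have hw : G.E a w := hN ▸ (hs.consistent_mem (consistent_hist hp N)).1
    refine hp' ((hσ w hw).sure (mem_playsFrom fun n => ?_))
    obtain ⟨M, hM⟩ := hsub (n + 1)
    refine ((hs.consistent_mem (consistent_hist hp M)).2 w hw).of_prefix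
      (hM.trans (mergeRun_mem_mono (hist_prefix p M.le_succ) w)) ?_
    simp [hist_succ]
  · intro g hg Ω _ P _ C hC
    have hnull : ∀ l : {l // g <+: l ∧ ¬ G.Consistent v (mergedStrat a s σ) l},
        P (C l.1) = 0 := by
      rintro ⟨l, hgl, hl⟩
      by_contra hne
      exact hl (hC.consistent hv hg hgl hne)
    have hbad : ∀ w : {w // G.E a w}, P (badEvent G.pas
        fun h => {ω | ∃ l, ω ∈ C l ∧ h <+: (mergeRun a s l).mem w.1}) = 0 := fun w =>
      (hσ w.1 w.2).almostSure _ ((hs.consistent_mem hg).2 w.1 w.2) Ω P _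
        (hs.randomRun hg.ne_nil hC w.2)
    refine measure_mono_null ?_
      (measure_union_null (measure_iUnion_null hnull) (measure_iUnion_null hbad))
    rintro ω ⟨p, hp, hω⟩
    by_cases hcons : ∃ l, (g <+: l ∧ ¬ G.Consistent v (mergedStrat a s σ) l) ∧ ω ∈ C l
    · obtain ⟨l, hl, hωl⟩ := hcons
      exact Or.inl (Set.mem_iUnion.2 ⟨⟨l, hl⟩, hωl⟩)
    right
    push Not at hcons
    obtain ⟨w, p', hp', hsub, N, hN⟩ :=
      exists_subplay_not_mem_parityWin (hub := a) (s := s) hp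
    have hcN : G.Consistent v (mergedStrat a s σ) (hist p (N + 1)) := by
      by_contra hcon
      have hωN := hω (N + 1)
      rcases hC.comparable hωN (hC.root _ hωN) with h1 | h1
      · exact hcon (hg.of_prefix h1 (by simp [hist_succ]))
      · exact hcons _ ⟨h1, hcon⟩ hωN
    refine Set.mem_iUnion.2 ⟨⟨w, hN ▸ (hs.consistent_mem hcN).1⟩, p', hp', fun n => ?_⟩
    obtain ⟨M, hM⟩ := hsub n
    exact ⟨hist p M, hω M, hM⟩

end Merging

theorem SASGame.determined (G : SASGame V) (v : V) :
    (∃ σ, G.StronglyWins v σ) ∨ G.Wins1 v := by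
  classical
  generalize hn : {u ∈ G.V1 | ∃ x y, G.E u x ∧ G.E u y ∧ x ≠ y}.ncard = n
  induction n using Nat.strong_induction_on generalizing G with
  | _ n ih =>
    by_cases huniq : ∀ u ∈ G.V1, ∀ x y, G.E u x → G.E u y → x = y
    · exact determined_of_subsingleton_choice huniq v
    push Not at huniq
    obtain ⟨a, ha, x, y, hx, hy, hxy⟩ := huniq
    by_cases hwin1 : ∃ w, ∃ hw : G.E a w, (G.restrict ha hw).Wins1 v
    · obtain ⟨w, hw, h⟩ := hwin1
      exact Or.inr h.of_restrict
    left
    push Not at hwin1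
    have hwin0 : ∀ w (hw : G.E a w), ∃ σ, (G.restrict ha hw).StronglyWins v σ := by
      intro w hw
      refine (ih _ ?_ (G.restrict ha hw) rfl).resolve_right (hwin1 w hw)
      rw [← hn]
      refine Set.ncard_lt_ncard ⟨?_, fun hsub => ?_⟩ (Set.toFinite _)
      · rintro u ⟨hu, x, y, hux, huy, hne⟩
        exact ⟨hu, x, y, hux.1, huy.1, hne⟩
      · obtain ⟨-, x', y', hx', hy', hne⟩ := hsub ⟨ha, x, y, hx, hy, hxy⟩
        exact hne ((hx'.2 rfl).trans (hy'.2 rfl).symm)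
    choose f hf using G.succ_nonempty
    have hchoice : ∀ w, ∃ σ, G.Valid0 σ ∧
        ∀ hw : G.E a w, (G.restrict ha hw).StronglyWins v σ := by
      intro w
      by_cases hw : G.E a w
      · obtain ⟨σ, hσ⟩ := hwin0 w hw
        exact ⟨σ, fun h u hu => (hσ.valid h u hu).1, fun _ => hσ⟩
      · exact ⟨fun _ u => f u, fun _ u _ => hf u, fun h => absurd h hw⟩
    choose σ hvalid hσ using hchoice
    by_cases hreach : ∃ w, ∃ hw : G.E a w, ∀ h, ¬ (G.restrict ha hw).Consistent v (σ w) (h ++ [a])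
    · obtain ⟨w, hw, havoid⟩ := hreach
      exact ⟨σ w, (hσ w hw).of_restrict havoid⟩
    push Not at hreach
    have hmem : ∀ w, ∃ h, ∀ hw : G.E a w, (G.restrict ha hw).Consistent v (σ w) (h ++ [a]) := by
      intro w
      by_cases hw : G.E a w
      · obtain ⟨h, hh⟩ := hreach w hw
        exact ⟨h, fun _ => hh⟩
      · exact ⟨[], fun h => absurd h hw⟩
    choose g hg using hmem
    let s : MergeState V := ⟨False, x, fun w => if w = x then [] else g w ++ [a]⟩
    have hs : G.Mergeable ha v σ s :=
      { not_atHub := id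
        edge := hx
        mem_mode := if_pos rfl
        mem_of_ne := fun w hw => ⟨g w, if_neg hw⟩
        consistent := fun w hw hne => by
          simp only [s, if_neg (show ¬ w = x from hne)]
          exact hg w hw }
    exact ⟨_, hs.stronglyWins hvalid hσ⟩

/-- Determinacy of SAS parity games: in every finite SAS parity
game and from every configuration `v`, either Player 0 wins from `v` or Player 1
wins from `v` (i.e., if Player 0 has no winning strategy from `v` then Player 1
has a single strategy `π` such that for every Player-0 strategy `σ`, either some
play from `v` consistent with `σ` and `π` violates the sure parity condition, or
the probability of the almost-sure parity condition in `v(σ,π)` is less than 1). -/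
theorem sas_determinacy (G : SASGame V) (v : V) :
    G.Wins0 v ∨ G.Wins1 v := by
  exact (G.determined v).imp_left fun ⟨_, hσ⟩ => hσ.wins0
end

section
/- Parity conditions are shuffle closed: let V be a finite set, p : V → ℕ a priority function, and W the parity condition induced by p (the set of infinite sequences over V in which the minimal priority occurring infinitely often is even). If r1 and r2 are infinite sequences over V that both belong to W, then every shuffle r of r1 and r2 belongs to W. -/
/-- The concatenation of the first `n` finite words of `u`. -/
def partialFlat {α : Type*} (u : ℕ → List α) (n : ℕ) : List α := ((List.range n).map u).flatten

/-- The infinite sequence `s` is the (infinite) concatenation `u 0 · u 1 · u 2 ⋯`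
of the finite words `u n`. -/
def IsConcatOf {α : Type*} (s : ℕ → α) (u : ℕ → List α) : Prop :=
  (∀ m, ∃ n, m ≤ (partialFlat u n).length) ∧
    ∀ (n i : ℕ) (h : i < (partialFlat u n).length), (partialFlat u n).get ⟨i, h⟩ = s i

/-- `r` is a shuffle of `r1` and `r2`: `r = u0 · u1 · u2 ⋯` for finite words `u i`
with `r1 = u0 · u2 · u4 ⋯` and `r2 = u1 · u3 · u5 ⋯`. -/
def IsShuffle {α : Type*} (r r1 r2 : ℕ → α) : Prop :=
  ∃ u : ℕ → List α, IsConcatOf r u ∧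
    IsConcatOf r1 (fun n => u (2 * n)) ∧ IsConcatOf r2 (fun n => u (2 * n + 1))

theorem partialFlat_succ {α : Type*} (u : ℕ → List α) (n : ℕ) :
    partialFlat u (n + 1) = partialFlat u n ++ u n := by
  simp [partialFlat, List.range_succ]

theorem monotone_length_partialFlat {α : Type*} (u : ℕ → List α) :
    Monotone fun n => (partialFlat u n).length :=
  monotone_nat_of_le_succ fun n => by simp [partialFlat_succ]

theorem exists_getElem_partialFlat_mem {α : Type*} (u : ℕ → List α) (N i : ℕ)
    (hN : (partialFlat u N).length ≤ i) (n : ℕ) (h : i < (partialFlat u n).length) :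
    ∃ m, N ≤ m ∧ (partialFlat u n)[i] ∈ u m := by
  induction n with
  | zero => simp [partialFlat] at h
  | succ n ih =>
    by_cases hi : i < (partialFlat u n).length
    · obtain ⟨m, hm, hmem⟩ := ih hi
      refine ⟨m, hm, ?_⟩
      simpa only [partialFlat_succ, List.getElem_append_left hi] using hmem
    · refine ⟨n, ?_, ?_⟩
      · by_contra hn
        have := monotone_length_partialFlat u (show n + 1 ≤ N by lia)
        dsimp only at this
        lia
      · simp only [partialFlat_succ, List.getElem_append_right (not_lt.mp hi)]
        exact List.getElem_mem _

theorem IsConcatOf.mem_infOcc_iff {α : Type*} {s : ℕ → α} {u : ℕ → List α}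
    (h : IsConcatOf s u) (v : α) : v ∈ InfOcc s ↔ ∀ N, ∃ m, N ≤ m ∧ v ∈ u m := by
  constructor
  · intro hv N
    obtain ⟨i, hi, rfl⟩ := hv (partialFlat u N).length
    obtain ⟨n, hn⟩ := h.1 (i + 1)
    rw [← h.2 n i hn]
    exact exists_getElem_partialFlat_mem u N i hi n hn
  · intro hv M
    obtain ⟨n, hn⟩ := h.1 M
    obtain ⟨m, hm, hmem⟩ := hv n
    obtain ⟨j, hj, rfl⟩ := List.mem_iff_getElem.mp hmem
    have hlen : (partialFlat u m).length + j < (partialFlat u (m + 1)).length := by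
      simpa [partialFlat_succ] using hj
    refine ⟨(partialFlat u m).length + j,
      (hn.trans (monotone_length_partialFlat u hm)).trans (Nat.le_add_right _ _), ?_⟩
    rw [← h.2 (m + 1) _ hlen]
    simp [partialFlat_succ]

theorem IsShuffle.infOcc_eq_union {α : Type*} {r r1 r2 : ℕ → α} (h : IsShuffle r r1 r2) :
    InfOcc r = InfOcc r1 ∪ InfOcc r2 := by
  obtain ⟨u, hr, h1, h2⟩ := h
  ext v
  rw [Set.mem_union, hr.mem_infOcc_iff, h1.mem_infOcc_iff, h2.mem_infOcc_iff]
  constructor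
  · intro hv
    by_contra! hc
    obtain ⟨⟨N1, hN1⟩, N2, hN2⟩ := hc
    obtain ⟨m, hm, hmem⟩ := hv (2 * N1 + 2 * N2 + 1)
    obtain ⟨k, rfl | rfl⟩ := m.even_or_odd'
    · exact hN1 k (by lia) hmem
    · exact hN2 k (by lia) hmem
  · rintro (hv | hv) N
    · obtain ⟨m, hm, hmem⟩ := hv N
      exact ⟨2 * m, by lia, hmem⟩
    · obtain ⟨m, hm, hmem⟩ := hv N
      exact ⟨2 * m + 1, by lia, hmem⟩

theorem infOcc_nonempty {α : Type*} [Finite α] (s : ℕ → α) : (InfOcc s).Nonempty := by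
  obtain ⟨v, hv⟩ := Finite.exists_infinite_fiber s
  refine ⟨v, fun n => ?_⟩
  obtain ⟨m, hm, hnm⟩ := (Set.infinite_coe_iff.mp hv).exists_gt n
  exact ⟨m, hnm.le, hm⟩

theorem IsShuffle.minPrio_eq_min {α : Type*} [Finite α] (p : α → ℕ) {r r1 r2 : ℕ → α}
    (h : IsShuffle r r1 r2) : minPrio p r = min (minPrio p r1) (minPrio p r2) := by
  unfold minPrio
  rw [h.infOcc_eq_union, Set.image_union]
  exact csInf_union (OrderBot.bddBelow _) ((infOcc_nonempty r1).image p)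
    (OrderBot.bddBelow _) ((infOcc_nonempty r2).image p)

/-- Parity conditions are shuffle closed: if `r1` and `r2` are in
the parity condition induced by `p`, then so is every shuffle of `r1` and `r2`. -/
theorem parity_shuffle_closed {V : Type} [Fintype V] (p : V → ℕ) (r r1 r2 : ℕ → V)
    (h1 : r1 ∈ ParityWin p) (h2 : r2 ∈ ParityWin p) (hr : IsShuffle r r1 r2) :
    r ∈ ParityWin p := by
  change Even (minPrio p r)
  rw [hr.minPrio_eq_min p]
  rcases min_choice (minPrio p r1) (minPrio p r2) with h | h <;> rw [h]
  · exact h1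
  · exact h2
end
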